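/- Let R and S be scalar formal pseudo-differential series over a differential ring, with S invertible, satisfying R⁺ = − S R S^{-1} and S⁺ = −S. Then for every positive integer i, the residue of the even power R^{2i} is a total derivative: res(R^{2i}) ∈ Im D. -/

import Mathlib

/-!
Formal pseudo-differential series over a commutative differential ring `(A, d)`.
A series `X = ∑_{i ≤ N} a_i D^i` is represented by its coefficient function
`ℤ → A` (the coefficient of `D^i`), with support bounded above.
-/

noncomputable section

/-- Generalized binomial coefficient `C(n, k)` for an integer `n`. -/
def gbinom (n : ℤ) (k : ℕ) : ℤ := Polynomial.eval n (descPochhammer ℤ k) / (k.factorial : ℤ)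

variable {A : Type*} [CommRing A]

/-- Support of a coefficient function is bounded above: genuine pseudo-differential series. -/
def PDSBdd (X : ℤ → A) : Prop := ∃ N : ℤ, ∀ i : ℤ, N < i → X i = 0

/-- Product of pseudo-differential series, induced by the extended Leibniz rule
`D^i ∘ a = ∑_{k ≥ 0} C(i,k) d^k(a) D^{i-k}`. -/
def pdsMul (d : A → A) (X Y : ℤ → A) : ℤ → A := fun n =>
  ∑ᶠ p : ℤ × ℕ, gbinom p.1 p.2 • (X p.1 * d^[p.2] (Y (n - p.1 + p.2)))

/-- The unit series `1 = D^0`. -/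
def pdsOne : ℤ → A := fun n => if n = 0 then 1 else 0

/-- Powers of a pseudo-differential series. -/
def pdsPow (d : A → A) (X : ℤ → A) : ℕ → ℤ → A
  | 0 => pdsOne
  | n + 1 => pdsMul d (pdsPow d X n) X

/-- Formal conjugate `X⁺ = ∑ (−D)^i ∘ a_i`. -/
def pdsConj (d : A → A) (X : ℤ → A) : ℤ → A := fun n =>
  ∑ᶠ k : ℕ, (((-1 : ℤˣ) ^ (n + (k : ℤ)) : ℤˣ) : ℤ) •
    (gbinom (n + k) k • d^[k] (X (n + k)))

/-- The residue: the coefficient of `D^{-1}`. -/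
def pdsRes (X : ℤ → A) : A := X (-1)

/-! ### Abstract part: a ring with a trace and an anti-involution -/

section abstract_trace

variable {B V : Type*} [Ring B] [AddCommGroup V]

theorem tr_pow_comm (τ : B →+ V) (hτ : ∀ x y, τ (x * y) = τ (y * x)) (u v : B) (n : ℕ) :
    τ ((u * v) ^ n) = τ ((v * u) ^ n) := by
  cases n with
  | zero => simp
  | succ n =>
    have h : ∀ m : ℕ, (u * v) ^ m * u = u * (v * u) ^ m := by
      intro m
      induction m with
      | zero => simp
      | succ m ih => rw [pow_succ', mul_assoc, ih, pow_succ']; simp only [mul_assoc]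
    rw [pow_succ, ← mul_assoc, h, mul_assoc, hτ, mul_assoc, ← pow_succ]

theorem sq_step (c x : B) (e : ℕ) : (c * x) ^ (2 ^ (e + 1)) = (c * (x * c * x)) ^ (2 ^ e) := by
  rw [pow_succ', pow_mul]
  congr 1
  noncomm_ring

variable (τ : B →+ V) (hτ : ∀ x y, τ (x * y) = τ (y * x)) (c : B) (σ : B →+ B)
  (h1 : ∀ x y, σ (x * c * y) = σ y * c * σ x) (h2 : ∀ x, σ (σ x) = x)
  (h3 : ∀ x, τ (c * σ x) = - τ (c * x))

include h1 h3 in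
theorem two_phi_fixed (e : ℕ) : ∀ w : B, σ w = w →
    τ ((c * w) ^ (2 ^ e)) + τ ((c * w) ^ (2 ^ e)) = 0 := by
  induction e with
  | zero =>
    intro w hw
    have := h3 w
    rw [hw] at this
    simp only [pow_zero, pow_one]
    nth_rewrite 1 [this]
    simp
  | succ e ih =>
    intro w hw
    rw [sq_step]
    exact ih _ (by rw [h1, hw])

include hτ h1 h2 h3 in
theorem phi_main (e : ℕ) :
    (∀ x y : B, σ x = x → σ y = y →
      τ ((c * (x + y)) ^ (2 ^ (e + 1))) = τ ((c * x) ^ (2 ^ (e + 1))) + τ ((c * y) ^ (2 ^ (e + 1))))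
    ∧ ∀ z : B, τ ((c * (z + σ z)) ^ (2 ^ (e + 1))) = 0 := by
  induction e with
  | zero =>
    have key : ∀ z, τ (c * (z + σ z)) = 0 := by
      intro z; rw [mul_add, map_add, h3]; simp
    constructor
    · intro x y hx hy
      have := key (x * c * y)
      rw [h1, hx, hy] at this
      simp only [zero_add, pow_one, pow_two]
      have e1 : c * (x + y) * (c * (x + y)) = c * x * (c * x) + c * y * (c * y)
        + c * (x * c * y + y * c * x) := by noncomm_ring
      rw [e1, map_add, this, map_add, add_zero]
    · intro z
      have k1 := key (z * c * z)
      have k2 := two_phi_fixed τ c σ h1 h3 0 (z * c * σ z) (by rw [h1, h2])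
      rw [h1] at k1
      simp only [pow_zero, pow_one] at k2
      simp only [zero_add, pow_one, pow_two]
      have e1 : c * (z + σ z) * (c * (z + σ z)) = c * (z * c * z + σ z * c * σ z)
        + (c * (z * c * σ z) + (c * σ z) * (c * z)) := by noncomm_ring
      rw [e1, map_add, k1, map_add, hτ (c * σ z)]
      have e2 : c * z * (c * σ z) = c * (z * c * σ z) := by noncomm_ring
      rw [e2, k2, add_zero]
  | succ e ih =>
    obtain ⟨ia, ib⟩ := ih
    constructor
    · intro x y hx hy
      rw [sq_step, sq_step c x, sq_step c y]
      have e1 : (x + y) * c * (x + y) = (x * c * x + y * c * y) + (x * c * y + σ (x * c * y)) := by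
        rw [h1, hx, hy]; noncomm_ring
      rw [e1, ia _ _ (by rw [map_add, h1, h1, hx, hy]) (by rw [map_add, h2, add_comm]), ib,
        ia _ _ (by rw [h1, hx]) (by rw [h1, hy]), add_zero]
    · intro z
      rw [sq_step]
      have e1 : (z + σ z) * c * (z + σ z)
          = (z * c * z + σ (z * c * z)) + (z * c * σ z + σ z * c * z) := by
        rw [h1]; noncomm_ring
      have f1 : σ (z * c * σ z) = z * c * σ z := by rw [h1, h2]
      have f2 : σ (σ z * c * z) = σ z * c * z := by rw [h1, h2]
      rw [e1, ia _ _ (by rw [map_add, h2, add_comm]) (by rw [map_add, f1, f2]), ib,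
        ia _ _ f1 f2]
      have e3 : c * (σ z * c * z) = (c * σ z) * (c * z) := by noncomm_ring
      have e4 : (c * z) * (c * σ z) = c * (z * c * σ z) := by noncomm_ring
      rw [e3, tr_pow_comm τ hτ (c * σ z), e4,
        two_phi_fixed τ c σ h1 h3 _ _ f1, add_zero]

include hτ h1 h2 h3 in
/-- On skew elements, `x ↦ τ ((c x)^(2^(e+1)))` is additive. -/
theorem phi_skew_add (e : ℕ) (x y : B) (hx : σ x = -x) (hy : σ y = -y) :
    τ ((c * (x + y)) ^ (2 ^ (e + 1)))
      = τ ((c * x) ^ (2 ^ (e + 1))) + τ ((c * y) ^ (2 ^ (e + 1))) := by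
  cases e with
  | zero =>
    have : τ (c * (x * c * y + y * c * x)) = 0 := by
      have := h3 (x * c * y)
      rw [h1, hx, hy] at this
      simp only [neg_mul, mul_neg, neg_neg] at this
      rw [mul_add, map_add, this]; simp
    simp only [zero_add, pow_one, pow_two]
    have e1 : c * (x + y) * (c * (x + y)) = c * x * (c * x) + c * y * (c * y)
      + c * (x * c * y + y * c * x) := by noncomm_ring
    rw [e1, map_add, this, map_add, add_zero]
  | succ e =>
    obtain ⟨ia, ib⟩ := phi_main τ hτ c σ h1 h2 h3 e
    rw [sq_step, sq_step c x, sq_step c y]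
    have e1 : (x + y) * c * (x + y) = (x * c * x + y * c * y) + (x * c * y + σ (x * c * y)) := by
      rw [h1, hx, hy]; noncomm_ring
    rw [e1, ia _ _ (by rw [map_add, h1, h1, hx, hy]; noncomm_ring)
      (by rw [map_add, h2, add_comm]), ib,
      ia _ _ (by rw [h1, hx]; noncomm_ring) (by rw [h1, hy]; noncomm_ring), add_zero]

end abstract_trace

/-! ### Binomials and signs -/

theorem gbinom_eq_choose (n : ℤ) (k : ℕ) : gbinom n k = Ring.choose n k := by
  have h := Ring.descPochhammer_eq_factorial_smul_choose n k
  rw [← Polynomial.eval_eq_smeval, nsmul_eq_mul] at h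
  rw [gbinom, h]
  exact Int.mul_ediv_cancel_left _ (by exact_mod_cast Nat.factorial_ne_zero k)

theorem gbinom_zero (n : ℤ) : gbinom n 0 = 1 := by
  rw [gbinom_eq_choose, Ring.choose_zero_right]

theorem gbinom_one (n : ℤ) : gbinom n 1 = n := by
  rw [gbinom_eq_choose, Ring.choose_one_right]

theorem gbinom_succ (n : ℤ) (k : ℕ) : gbinom (n + 1) (k + 1) = gbinom n k + gbinom n (k + 1) := by
  simp only [gbinom_eq_choose, Ring.choose_succ_succ]

theorem gbinom_zero_left (k : ℕ) : gbinom 0 (k + 1) = 0 := by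
  rw [gbinom_eq_choose, Ring.choose_zero_succ]

theorem gbinom_nat_lt (n k : ℕ) (h : n < k) : gbinom (n : ℤ) k = 0 := by
  rw [gbinom_eq_choose, Ring.choose_natCast, Nat.choose_eq_zero_of_lt h]; rfl

/-- The sign `(-1)^n`. -/
def sgn (n : ℤ) : ℤ := (((-1 : ℤˣ) ^ n : ℤˣ) : ℤ)

theorem sgn_add (m n : ℤ) : sgn (m + n) = sgn m * sgn n := by
  simp [sgn, zpow_add]

theorem sgn_one : sgn 1 = -1 := by simp [sgn]

theorem sgn_zero : sgn 0 = 1 := by simp [sgn]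

theorem sgn_mul_self (m : ℤ) : sgn m * sgn m = 1 := by
  rw [sgn, ← Units.val_mul, Int.units_mul_self]; rfl

theorem sgn_even (m : ℤ) : sgn (2 * m) = 1 := by rw [two_mul, sgn_add, sgn_mul_self]

theorem sgn_odd (m : ℤ) : sgn (2 * m + 1) = -1 := by rw [sgn_add, sgn_even, sgn_one]; rfl

/-! ### The ring of pseudo-differential series -/

/-- Series of order at most `N`. -/
def ordLE (A : Type*) [CommRing A] (N : ℤ) : AddSubgroup (ℤ → A) where
  carrier := {X | ∀ i, N < i → X i = 0}
  zero_mem' := fun _ _ => rfl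
  add_mem' := fun {a b} ha hb i hi => by simp [ha i hi, hb i hi]
  neg_mem' := fun {a} ha i hi => by simp [ha i hi]

theorem mem_ordLE {N : ℤ} {X : ℤ → A} : X ∈ ordLE A N ↔ ∀ i, N < i → X i = 0 := Iff.rfl

theorem ordLE_mono {M N : ℤ} (h : M ≤ N) {X : ℤ → A} (hX : X ∈ ordLE A M) : X ∈ ordLE A N :=
  fun i hi => hX i (by omega)

/-- The additive group of series. -/
def bddSub (A : Type*) [CommRing A] : AddSubgroup (ℤ → A) where
  carrier := {X | ∃ N, X ∈ ordLE A N}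
  zero_mem' := ⟨0, zero_mem _⟩
  add_mem' := fun {a b} ⟨N, ha⟩ ⟨M, hb⟩ => ⟨max N M,
    add_mem (ordLE_mono (le_max_left _ _) ha) (ordLE_mono (le_max_right _ _) hb)⟩
  neg_mem' := fun {_} ⟨N, ha⟩ => ⟨N, neg_mem ha⟩

/-- Pseudo-differential series over `(A, d)`, to carry the product. -/
def PDS (_d : Derivation ℤ A A) : Type _ := bddSub A

variable {d : Derivation ℤ A A}

instance : AddCommGroup (PDS d) := inferInstanceAs (AddCommGroup (bddSub A))

/-- Coefficient. -/
def PDS.cf (n : ℤ) : PDS d →+ A where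
  toFun X := X.1 n
  map_zero' := rfl
  map_add' _ _ := rfl

/-- Order at most `N`, in the ring. -/
def PDS.O (d : Derivation ℤ A A) (N : ℤ) : AddSubgroup (PDS d) where
  carrier := {X | ∀ i, N < i → PDS.cf i X = 0}
  zero_mem' := fun _ _ => rfl
  add_mem' := fun {a b} ha hb i hi => by rw [map_add, ha i hi, hb i hi, add_zero]
  neg_mem' := fun {a} ha i hi => by rw [map_neg, ha i hi, neg_zero]

theorem PDS.mem_O {N : ℤ} {X : PDS d} : X ∈ PDS.O d N ↔ ∀ i, N < i → PDS.cf i X = 0 := Iff.rfl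

theorem PDS.O_mono {M N : ℤ} (h : M ≤ N) {X : PDS d} (hX : X ∈ PDS.O d M) : X ∈ PDS.O d N :=
  fun i hi => hX i (by omega)

theorem PDS.exists_O (X : PDS d) : ∃ N, X ∈ PDS.O d N := X.2

@[ext] theorem PDS.ext {X Y : PDS d} (h : ∀ n, PDS.cf n X = PDS.cf n Y) : X = Y :=
  Subtype.ext (funext h)

theorem diter_zero (k : ℕ) : (⇑d)^[k] 0 = 0 := iterate_map_zero d k

theorem diter_add (k : ℕ) (x y : A) : (⇑d)^[k] (x + y) = (⇑d)^[k] x + (⇑d)^[k] y :=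
  iterate_map_add d k x y

theorem diter_one (k : ℕ) : (⇑d)^[k + 1] 1 = 0 := by
  rw [Function.iterate_succ_apply, Derivation.map_one_eq_zero, diter_zero]

theorem pdsMul_term_zero {a b : ℤ} {X Y : ℤ → A} (hX : X ∈ ordLE A a) (hY : Y ∈ ordLE A b) (n : ℤ)
    (p : ℤ × ℕ) (h : a < p.1 ∨ b < n - p.1 + p.2) :
    gbinom p.1 p.2 • (X p.1 * (⇑d)^[p.2] (Y (n - p.1 + p.2))) = 0 := by
  rcases h with h | h
  · rw [hX _ h]; simp
  · rw [hY _ h, diter_zero]; simp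

theorem pdsMul_fin {a b : ℤ} {X Y : ℤ → A} (hX : X ∈ ordLE A a) (hY : Y ∈ ordLE A b) (n : ℤ) :
    (fun p : ℤ × ℕ => gbinom p.1 p.2 • (X p.1 * (⇑d)^[p.2] (Y (n - p.1 + p.2)))).HasFiniteSupport := by
  refine Set.Finite.subset ((Set.finite_Icc (n - b) a).prod
    (Set.finite_Iic ((a + b - n).toNat))) ?_
  intro p hp
  by_contra hc
  apply hp
  refine pdsMul_term_zero hX hY n p ?_
  by_contra! h
  apply hc
  simp only [Set.mem_prod, Set.mem_Icc, Set.mem_Iic]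
  omega

theorem pdsMul_ord {a b : ℤ} {X Y : ℤ → A} (hX : X ∈ ordLE A a) (hY : Y ∈ ordLE A b) :
    pdsMul (⇑d) X Y ∈ ordLE A (a + b) := by
  intro n hn
  rw [pdsMul]
  apply finsum_eq_zero_of_forall_eq_zero
  intro p
  refine pdsMul_term_zero hX hY n p ?_
  by_contra! h
  omega

instance : Mul (PDS d) where
  mul X Y := ⟨pdsMul (⇑d) X.1 Y.1, by
    obtain ⟨a, ha⟩ := X.2
    obtain ⟨b, hb⟩ := Y.2
    exact ⟨a + b, pdsMul_ord ha hb⟩⟩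

/-- Monomial `a D^i`. -/
def PDS.mon (d : Derivation ℤ A A) (a : A) (i : ℤ) : PDS d :=
  ⟨fun n => if n = i then a else 0, i, fun n hn => if_neg (by omega)⟩

instance : One (PDS d) := ⟨PDS.mon d 1 0⟩

theorem PDS.one_def : (1 : PDS d) = PDS.mon d 1 0 := rfl

namespace PDS

theorem mul_val (X Y : PDS d) : (X * Y).1 = pdsMul (⇑d) X.1 Y.1 := rfl

theorem cf_mul (X Y : PDS d) (n : ℤ) : cf n (X * Y) = ∑ᶠ p : ℤ × ℕ,
    gbinom p.1 p.2 • (cf p.1 X * (⇑d)^[p.2] (cf (n - p.1 + p.2) Y)) := rfl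

theorem cf_mon (a : A) (i n : ℤ) : cf n (mon d a i) = if n = i then a else 0 := rfl

theorem mon_O (a : A) (i : ℤ) : mon d a i ∈ O d i := fun n hn => if_neg (by omega)

theorem mul_O {a b : ℤ} {X Y : PDS d} (hX : X ∈ O d a) (hY : Y ∈ O d b) : X * Y ∈ O d (a + b) :=
  pdsMul_ord (X := X.1) (Y := Y.1) hX hY

theorem add_mul' (X Y Z : PDS d) : (X + Y) * Z = X * Z + Y * Z := by
  obtain ⟨a, ha⟩ := X.exists_O
  obtain ⟨b, hb⟩ := Y.exists_O
  obtain ⟨c, hc⟩ := Z.exists_O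
  ext n
  rw [map_add, cf_mul, cf_mul, cf_mul, ← finsum_add_distrib (pdsMul_fin ha hc n) (pdsMul_fin hb hc n)]
  apply finsum_congr
  intro p
  rw [map_add, add_mul, smul_add]

theorem mul_add' (X Y Z : PDS d) : X * (Y + Z) = X * Y + X * Z := by
  obtain ⟨a, ha⟩ := X.exists_O
  obtain ⟨b, hb⟩ := Y.exists_O
  obtain ⟨c, hc⟩ := Z.exists_O
  ext n
  rw [map_add, cf_mul, cf_mul, cf_mul, ← finsum_add_distrib (pdsMul_fin ha hb n) (pdsMul_fin ha hc n)]
  apply finsum_congr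
  intro p
  rw [map_add, diter_add, mul_add, smul_add]

instance : NonUnitalNonAssocRing (PDS d) :=
  { (inferInstance : AddCommGroup (PDS d)), (inferInstance : Mul (PDS d)) with
    left_distrib := mul_add'
    right_distrib := add_mul'
    zero_mul := fun X => by
      have := add_mul' (0 : PDS d) 0 X
      rwa [add_zero, left_eq_add] at this
    mul_zero := fun X => by
      have := mul_add' X (0 : PDS d) 0
      rwa [add_zero, left_eq_add] at this }

/-- Reduction to monomials. -/
theorem hom_ext {G : Type*} [AddGroup G] (f g : PDS d →+ G)
    (hlow : ∃ N, ∀ X ∈ O d N, f X = g X) (hm : ∀ a i, f (mon d a i) = g (mon d a i)) : f = g := by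
  obtain ⟨N, hN⟩ := hlow
  have key : ∀ k : ℕ, ∀ X ∈ O d (N + k), f X = g X := by
    intro k
    induction k with
    | zero => simpa using hN
    | succ k ih =>
      intro X hX
      have h : X - mon d (cf (N + k + 1) X) (N + k + 1) ∈ O d (N + k) := by
        intro i hi
        rw [map_sub, cf_mon]
        split_ifs with h
        · rw [h, sub_self]
        · rw [hX i (by push_cast; omega), sub_zero]
      have e : X = (X - mon d (cf (N + k + 1) X) (N + k + 1)) + mon d (cf (N + k + 1) X) (N + k + 1) :=
        by rw [sub_add_cancel]
      rw [e, map_add, map_add, ih _ h, hm]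
  ext X
  obtain ⟨M, hM⟩ := X.exists_O
  exact key (M - N).toNat X (O_mono (by omega) hM)

/-- Reduction to monomials, for maps to series of finite degree. -/
theorem hom_ext_pds (f g : PDS d →+ PDS d) (r : ℤ)
    (hf : ∀ N, ∀ X ∈ O d N, f X ∈ O d (N + r)) (hg : ∀ N, ∀ X ∈ O d N, g X ∈ O d (N + r))
    (hm : ∀ a i, f (mon d a i) = g (mon d a i)) : ∀ X, f X = g X := by
  intro X
  ext n
  have := hom_ext ((cf n).comp f) ((cf n).comp g) ⟨n - r - 1, fun Y hY => by
    simp only [AddMonoidHom.comp_apply]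
    rw [hf _ Y hY n (by omega), hg _ Y hY n (by omega)]⟩
    (fun a i => by simp only [AddMonoidHom.comp_apply, hm])
  exact DFunLike.congr_fun this X

theorem cf_mon_mul_mon (a b : A) (i j n : ℤ) : cf n (mon d a i * mon d b j)
    = if n ≤ i + j then gbinom i (i + j - n).toNat • (a * (⇑d)^[(i + j - n).toNat] b) else 0 := by
  rw [cf_mul, finsum_eq_single _ (i, (i + j - n).toNat)]
  · simp only [cf_mon, if_true]
    split_ifs with h1 h2 h2
    · rfl
    · omega
    · omega
    · simp [diter_zero]
  · rintro ⟨p, k⟩ hp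
    simp only [cf_mon]
    split_ifs with h1 h2
    · exfalso; apply hp; ext <;> simp <;> omega
    · simp [diter_zero]
    · simp
    · simp

theorem cf_mon_mul_mon_sub (a b : A) (i j : ℤ) (k : ℕ) : cf (i + j - k) (mon d a i * mon d b j)
    = gbinom i k • (a * (⇑d)^[k] b) := by
  rw [cf_mon_mul_mon, if_pos (by omega)]
  congr <;> omega

/-- Two series of order at most `N` are equal if coefficients at `N - k` are. -/
theorem ext_sub {X Y : PDS d} (N : ℤ) (hX : X ∈ O d N) (hY : Y ∈ O d N)
    (h : ∀ k : ℕ, cf (N - k) X = cf (N - k) Y) : X = Y := by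
  ext n
  by_cases hn : N < n
  · rw [hX n hn, hY n hn]
  · have := h (N - n).toNat
    rwa [show N - ((N - n).toNat : ℤ) = n by omega] at this

theorem mon_mul_mon_one (a : A) (i j : ℤ) : mon d a i * mon d 1 j = mon d a (i + j) := by
  refine ext_sub (i + j) (mul_O (mon_O _ _) (mon_O _ _)) (mon_O _ _) ?_
  intro k
  rw [cf_mon_mul_mon_sub, cf_mon]
  cases k with
  | zero => simp [gbinom_zero]
  | succ k => rw [diter_one, if_neg (by omega)]; simp

theorem mon_zero_mul_mon (a b : A) (j : ℤ) : mon d a 0 * mon d b j = mon d (a * b) j := by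
  refine ext_sub (0 + j) (mul_O (mon_O _ _) (mon_O _ _)) (O_mono (by omega) (mon_O _ _)) ?_
  intro k
  rw [cf_mon_mul_mon_sub, cf_mon]
  cases k with
  | zero => simp [gbinom_zero]
  | succ k => rw [gbinom_zero_left, if_neg (by omega)]; simp

theorem mon_add (a b : A) (i : ℤ) : mon d (a + b) i = mon d a i + mon d b i := by
  ext n; rw [map_add, cf_mon, cf_mon, cf_mon]; split_ifs <;> simp

theorem mon_neg (a : A) (i : ℤ) : mon d (-a) i = - mon d a i := by
  ext n; rw [map_neg, cf_mon, cf_mon]; split_ifs <;> simp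

theorem D_mul_mon (a : A) (i : ℤ) : mon d 1 1 * mon d a i = mon d a (i + 1) + mon d (d a) i := by
  refine ext_sub (1 + i) (mul_O (mon_O _ _) (mon_O _ _))
    (add_mem (O_mono (by omega) (mon_O _ _)) (O_mono (by omega) (mon_O _ _))) ?_
  intro k
  rw [cf_mon_mul_mon_sub, map_add, cf_mon, cf_mon]
  match k with
  | 0 => rw [gbinom_zero, if_pos (by push_cast; omega), if_neg (by push_cast; omega)]; simp
  | 1 => rw [gbinom_one, if_neg (by push_cast; omega), if_pos (by push_cast; omega)]; simp
  | k + 2 =>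
    rw [show (1 : ℤ) = ((1 : ℕ) : ℤ) by rfl, gbinom_nat_lt 1 (k + 2) (by omega),
      if_neg (by push_cast; omega), if_neg (by push_cast; omega)]
    simp

/-- Left multiplication by `D`. -/
theorem cf_D_mul (X : PDS d) (n : ℤ) : cf n (mon d 1 1 * X) = cf (n - 1) X + d (cf n X) := by
  have := hom_ext ((cf n).comp (AddMonoidHom.mulLeft (mon d 1 1)))
    (cf (n - 1) + (d : A →+ A).comp (cf n)) ⟨n - 2, fun Y hY => by
      simp only [AddMonoidHom.comp_apply, AddMonoidHom.add_apply, AddMonoidHom.coe_mulLeft]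
      rw [mul_O (mon_O 1 1) hY n (by omega), hY n (by omega), hY (n - 1) (by omega)]
      simp⟩ (fun a i => by
      simp only [AddMonoidHom.comp_apply, AddMonoidHom.add_apply, AddMonoidHom.coe_mulLeft,
        D_mul_mon, map_add, cf_mon]
      congr 1
      · split_ifs <;> first | rfl | omega
      · split_ifs <;> simp)
  exact DFunLike.congr_fun this X

theorem D_mul_mon_mul_mon (b c : A) (j l : ℤ) :
    mon d 1 1 * (mon d b j * mon d c l) = (mon d 1 1 * mon d b j) * mon d c l := by
  have hO := mul_O (mon_O (d := d) b j) (mon_O c l)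
  refine ext_sub (1 + j + l) (O_mono (by omega) (mul_O (mon_O 1 1) hO))
    (mul_O (mul_O (mon_O _ _) (mon_O _ _)) (mon_O _ _)) ?_
  intro k
  rw [D_mul_mon, cf_D_mul, add_mul, map_add,
    show 1 + j + l - (k : ℤ) = (j + 1) + l - k by ring, cf_mon_mul_mon_sub]
  cases k with
  | zero =>
    rw [show j + 1 + l - ((0 : ℕ) : ℤ) - 1 = j + l - (0 : ℕ) by push_cast; ring, cf_mon_mul_mon_sub,
      hO _ (by push_cast; omega), mul_O (mon_O _ _) (mon_O _ _) _ (by push_cast; omega)]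
    simp [gbinom_zero]
  | succ k =>
    rw [show j + 1 + l - ((k + 1 : ℕ) : ℤ) - 1 = j + l - (k + 1 : ℕ) by push_cast; ring,
      show j + 1 + l - ((k + 1 : ℕ) : ℤ) = j + l - (k : ℕ) by push_cast; ring,
      cf_mon_mul_mon_sub, cf_mon_mul_mon_sub, cf_mon_mul_mon_sub, gbinom_succ]
    rw [map_zsmul, Derivation.leibniz, Function.iterate_succ_apply']
    simp only [smul_eq_mul, zsmul_eq_mul]
    push_cast
    ring

theorem D_assoc (Y Z : PDS d) : mon d 1 1 * (Y * Z) = (mon d 1 1 * Y) * Z := by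
  obtain ⟨z, hz⟩ := Z.exists_O
  refine hom_ext_pds ((AddMonoidHom.mulLeft (mon d 1 1)).comp (AddMonoidHom.mulRight Z))
    ((AddMonoidHom.mulRight Z).comp (AddMonoidHom.mulLeft (mon d 1 1))) (1 + z) ?_ ?_ ?_ Y
  · intro N X hX
    exact O_mono (by omega) (mul_O (mon_O _ _) (mul_O hX hz))
  · intro N X hX
    exact O_mono (by omega) (mul_O (mul_O (mon_O _ _) hX) hz)
  · intro b j
    refine hom_ext_pds ((AddMonoidHom.mulLeft (mon d 1 1)).comp (AddMonoidHom.mulLeft (mon d b j)))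
      (AddMonoidHom.mulLeft (mon d 1 1 * mon d b j)) (1 + j) ?_ ?_ ?_ Z
    · intro N X hX
      exact O_mono (by omega) (mul_O (mon_O _ _) (mul_O (mon_O _ _) hX))
    · intro N X hX
      exact O_mono (by omega) (mul_O (mul_O (mon_O _ _) (mon_O _ _)) hX)
    · intro c l
      exact D_mul_mon_mul_mon b c j l

theorem cf_smul_mul (a : A) (X : PDS d) (n : ℤ) : cf n (mon d a 0 * X) = a * cf n X := by
  have := hom_ext ((cf n).comp (AddMonoidHom.mulLeft (mon d a 0)))
    ((AddMonoidHom.mulLeft a).comp (cf n)) ⟨n - 1, fun Y hY => by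
      simp only [AddMonoidHom.comp_apply, AddMonoidHom.coe_mulLeft]
      rw [mul_O (mon_O a 0) hY n (by omega), hY n (by omega)]
      simp⟩ (fun b i => by
      simp only [AddMonoidHom.comp_apply, AddMonoidHom.coe_mulLeft, mon_zero_mul_mon, cf_mon]
      split_ifs <;> simp)
  exact DFunLike.congr_fun this X

theorem smul_assoc' (a : A) (Y Z : PDS d) : mon d a 0 * (Y * Z) = (mon d a 0 * Y) * Z := by
  ext n
  obtain ⟨y, hy⟩ := Y.exists_O
  obtain ⟨z, hz⟩ := Z.exists_O
  rw [cf_smul_mul, cf_mul, cf_mul, ← AddMonoidHom.coe_mulLeft,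
    AddMonoidHom.map_finsum _ (pdsMul_fin hy hz n)]
  apply finsum_congr
  intro p
  rw [cf_smul_mul, AddMonoidHom.coe_mulLeft]
  simp only [zsmul_eq_mul]
  ring

theorem D_mul_Dinv_mul (X : PDS d) : mon d 1 1 * (mon d 1 (-1) * X) = X := by
  rw [D_assoc, mon_mul_mon_one]
  ext n
  rw [show (1 : ℤ) + -1 = 0 by norm_num, cf_smul_mul, one_mul]

theorem D_mul_inj (X : PDS d) (h : mon d 1 1 * X = 0) : X = 0 := by
  obtain ⟨x, hx⟩ := X.exists_O
  have key : ∀ k : ℕ, ∀ n, x - k < n → cf n X = 0 := by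
    intro k
    induction k with
    | zero => intro n hn; exact hx n (by simpa using hn)
    | succ k ih =>
      intro n hn
      have h1 := cf_D_mul X (n + 1)
      rw [h, ih (n + 1) (by push_cast at hn; omega)] at h1
      simpa using h1.symm
  ext n
  exact key (x - n + 1).toNat n (by omega)

theorem Dinv_assoc (Y Z : PDS d) : mon d 1 (-1) * (Y * Z) = (mon d 1 (-1) * Y) * Z := by
  rw [← sub_eq_zero]
  apply D_mul_inj
  rw [mul_sub, D_mul_Dinv_mul, D_assoc, D_mul_Dinv_mul, sub_self]

theorem assoc_mul {X X' : PDS d} (h : ∀ Y Z, X * (Y * Z) = (X * Y) * Z)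
    (h' : ∀ Y Z, X' * (Y * Z) = (X' * Y) * Z) (Y Z : PDS d) :
    (X * X') * (Y * Z) = ((X * X') * Y) * Z := by
  rw [← h, h', h, h]

theorem Dpow_assoc (i : ℤ) : ∀ Y Z : PDS d, mon d 1 i * (Y * Z) = (mon d 1 i * Y) * Z := by
  induction i with
  | zero => exact smul_assoc' 1
  | succ i ih =>
    rw [← mon_mul_mon_one]
    exact assoc_mul ih D_assoc
  | pred i ih =>
    rw [sub_eq_add_neg, ← mon_mul_mon_one]
    exact assoc_mul ih Dinv_assoc

theorem mon_eq (a : A) (i : ℤ) : mon d a i = mon d a 0 * mon d 1 i := by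
  rw [mon_mul_mon_one, zero_add]

theorem mul_assoc' (X Y Z : PDS d) : (X * Y) * Z = X * (Y * Z) := by
  obtain ⟨y, hy⟩ := Y.exists_O
  obtain ⟨z, hz⟩ := Z.exists_O
  refine hom_ext_pds ((AddMonoidHom.mulRight Z).comp (AddMonoidHom.mulRight Y))
    (AddMonoidHom.mulRight (Y * Z)) (y + z) ?_ ?_ ?_ X
  · intro N X hX
    exact O_mono (by omega) (mul_O (mul_O hX hy) hz)
  · intro N X hX
    exact mul_O hX (mul_O hy hz)
  · intro a i
    change (mon d a i * Y) * Z = mon d a i * (Y * Z)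
    rw [mon_eq]
    exact (assoc_mul (smul_assoc' a) (Dpow_assoc i) Y Z).symm

theorem one_mul' (X : PDS d) : 1 * X = X := by
  ext n; rw [one_def, cf_smul_mul, one_mul]

theorem mul_one' (X : PDS d) : X * 1 = X := by
  refine hom_ext_pds (AddMonoidHom.mulRight 1) (AddMonoidHom.id _) 0 ?_ ?_ ?_ X
  · intro N X hX
    exact mul_O hX (mon_O 1 0)
  · intro N X hX
    simpa using hX
  · intro a i
    change mon d a i * mon d 1 0 = mon d a i
    rw [mon_mul_mon_one, add_zero]

instance : Ring (PDS d) :=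
  { (inferInstance : NonUnitalNonAssocRing (PDS d)), (inferInstance : One (PDS d)) with
    mul_assoc := mul_assoc'
    one_mul := one_mul'
    mul_one := mul_one' }

/-! ### Conjugation -/

theorem conj_term_zero {N : ℤ} {X : ℤ → A} (hX : X ∈ ordLE A N) (n : ℤ) (k : ℕ) (h : N < n + k) :
    sgn (n + k) • (gbinom (n + k) k • (⇑d)^[k] (X (n + k))) = 0 := by
  rw [hX _ h, diter_zero, smul_zero, smul_zero]

theorem conj_fin {N : ℤ} {X : ℤ → A} (hX : X ∈ ordLE A N) (n : ℤ) :
    (fun k : ℕ => sgn (n + k) • (gbinom (n + k) k • (⇑d)^[k] (X (n + k)))).HasFiniteSupport := by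
  refine Set.Finite.subset (Set.finite_Iic ((N - n).toNat)) ?_
  intro k hk
  by_contra hc
  apply hk
  refine conj_term_zero hX n k ?_
  simp only [Set.mem_Iic] at hc
  omega

theorem conj_ord {N : ℤ} {X : ℤ → A} (hX : X ∈ ordLE A N) : pdsConj (⇑d) X ∈ ordLE A N := by
  intro n hn
  exact finsum_eq_zero_of_forall_eq_zero fun k => conj_term_zero hX n k (by omega)

/-- Formal conjugation as an additive map. -/
def cj : PDS d →+ PDS d where
  toFun X := ⟨pdsConj (⇑d) X.1, by obtain ⟨N, hN⟩ := X.2; exact ⟨N, conj_ord hN⟩⟩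
  map_zero' := by
    ext n
    exact finsum_eq_zero_of_forall_eq_zero fun k =>
      conj_term_zero (zero_mem (ordLE A (n - 1))) n k (by omega)
  map_add' X Y := by
    obtain ⟨a, ha⟩ := X.exists_O
    obtain ⟨b, hb⟩ := Y.exists_O
    ext n
    refine Eq.trans ?_ (finsum_add_distrib (conj_fin ha n) (conj_fin hb n))
    apply finsum_congr
    intro k
    change sgn (n + k) • (gbinom (n + k) k • (⇑d)^[k] (X.1 (n + k) + Y.1 (n + k))) = _
    rw [diter_add, smul_add, smul_add]
    rfl

theorem cj_val (X : PDS d) : (cj X).1 = pdsConj (⇑d) X.1 := rfl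

theorem cf_cj (X : PDS d) (n : ℤ) : cf n (cj X) =
    ∑ᶠ k : ℕ, sgn (n + k) • (gbinom (n + k) k • (⇑d)^[k] (cf (n + k) X)) := rfl

theorem cj_O {N : ℤ} {X : PDS d} (hX : X ∈ O d N) : cj X ∈ O d N :=
  conj_ord (X := X.1) hX

theorem cf_cj_top {N : ℤ} {X : PDS d} (hX : X ∈ O d N) : cf N (cj X) = sgn N • cf N X := by
  rw [cf_cj, finsum_eq_single _ 0]
  · simp [gbinom_zero]
  · intro k hk
    exact conj_term_zero hX N k (by omega)

theorem cf_cj_sub {N : ℤ} {X : PDS d} (hX : X ∈ O d N) :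
    cf (N - 1) (cj X) = sgn (N - 1) • cf (N - 1) X + sgn N • (N • d (cf N X)) := by
  rw [cf_cj, finsum_eq_sum_of_support_subset (s := {0, 1})]
  · rw [Finset.sum_pair (by norm_num)]
    simp [gbinom_zero, gbinom_one]
  · intro k hk
    by_contra hc
    apply hk
    refine conj_term_zero hX (N - 1) k ?_
    simp only [Finset.coe_insert, Finset.coe_singleton, Set.mem_insert_iff,
      Set.mem_singleton_iff] at hc
    omega

theorem cj_mon (a : A) (i : ℤ) : cj (mon d a i) = sgn i • (mon d 1 i * mon d a 0) := by
  ext n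
  rw [map_zsmul, cf_mon_mul_mon, cf_cj]
  rw [finsum_eq_single _ (i - n).toNat]
  · rw [cf_mon]
    split_ifs with h1 h2 h2
    · rw [h1]; simp
    · omega
    · omega
    · simp [diter_zero]
  · intro k hk
    rw [cf_mon, if_neg (by omega), diter_zero]; simp

theorem Dpow_mul (i j : ℤ) : mon d 1 i * mon d 1 j = mon d 1 (i + j) := mon_mul_mon_one 1 i j

theorem sgn_smul_smul (i : ℤ) (X : PDS d) : sgn i • (sgn i • X) = X := by
  rw [smul_smul, sgn_mul_self, one_smul]

/-- `(X D^j)⁺ = (-D)^j X⁺`. -/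
theorem cj_mul_D (X : PDS d) (j : ℤ) : cj (X * mon d 1 j) = sgn j • (mon d 1 j * cj X) := by
  refine hom_ext_pds (cj.comp (AddMonoidHom.mulRight (mon d 1 j)))
    (((AddMonoidHom.mulLeft (sgn j • mon d 1 j))).comp cj) j ?_ ?_ ?_ X |>.trans ?_
  · intro N X hX; exact cj_O (mul_O hX (mon_O _ _))
  · intro N X hX
    exact O_mono (by omega) (mul_O (zsmul_mem (mon_O _ _) _) (cj_O hX))
  · intro a i
    change cj (mon d a i * mon d 1 j) = sgn j • mon d 1 j * cj (mon d a i)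
    rw [mon_mul_mon_one, cj_mon, cj_mon, add_comm i j, sgn_add, ← Dpow_mul]
    simp only [smul_mul_assoc, mul_smul_comm, smul_smul, mul_assoc]
    rw [mul_comm (sgn j)]
  · change sgn j • mon d 1 j * cj X = _
    rw [smul_mul_assoc]

/-- `(a X)⁺ = X⁺ a`. -/
theorem cj_smul (a : A) (X : PDS d) : cj (mon d a 0 * X) = cj X * mon d a 0 := by
  refine hom_ext_pds (cj.comp (AddMonoidHom.mulLeft (mon d a 0)))
    (((AddMonoidHom.mulRight (mon d a 0))).comp cj) 0 ?_ ?_ ?_ X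
  · intro N X hX; exact cj_O (O_mono (by omega) (mul_O (mon_O _ _) hX))
  · intro N X hX
    exact mul_O (cj_O hX) (mon_O _ _)
  · intro b i
    change cj (mon d a 0 * mon d b i) = cj (mon d b i) * mon d a 0
    rw [mon_zero_mul_mon, cj_mon, cj_mon, smul_mul_assoc, mul_assoc, mon_zero_mul_mon, mul_comm a b]

/-- `(D X)⁺ = -X⁺ D`. -/
theorem cj_D_mul (X : PDS d) : cj (mon d 1 1 * X) = -(cj X * mon d 1 1) := by
  refine hom_ext_pds (cj.comp (AddMonoidHom.mulLeft (mon d 1 1)))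
    (-((AddMonoidHom.mulRight (mon d 1 1))).comp cj) 1 ?_ ?_ ?_ X
  · intro N X hX; exact cj_O (O_mono (by omega) (mul_O (mon_O _ _) hX))
  · intro N X hX
    exact neg_mem (mul_O (cj_O hX) (mon_O _ _))
  · intro b i
    change cj (mon d 1 1 * mon d b i) = -(cj (mon d b i) * mon d 1 1)
    rw [D_mul_mon, map_add, cj_mon, cj_mon, cj_mon, sgn_add, sgn_one, ← Dpow_mul]
    rw [mul_assoc, D_mul_mon, mul_add, smul_mul_assoc, mul_assoc, mon_mul_mon_one]
    simp only [mul_neg_one, neg_smul, smul_add]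
    abel

theorem cj_Dinv_mul (X : PDS d) : cj (mon d 1 (-1) * X) = -(cj X * mon d 1 (-1)) := by
  have h := cj_D_mul (mon d 1 (-1) * X)
  rw [D_mul_Dinv_mul] at h
  rw [h, neg_mul, mul_assoc, Dpow_mul, neg_neg]
  exact (mul_one _).symm

theorem cj_Dpow_mul (i : ℤ) : ∀ X : PDS d, cj (mon d 1 i * X) = sgn i • (cj X * mon d 1 i) := by
  induction i with
  | zero => intro X; rw [cj_smul, sgn_zero, one_smul]
  | succ i ih =>
    intro X
    rw [← Dpow_mul, mul_assoc, ih, cj_D_mul, sgn_add, sgn_one, neg_mul, mul_assoc, Dpow_mul, Dpow_mul,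
      add_comm 1 (i : ℤ)]
    simp
  | pred i ih =>
    intro X
    have hs : sgn (-1) = -1 := by simp [sgn]
    rw [sub_eq_add_neg, ← Dpow_mul, mul_assoc, ih, cj_Dinv_mul, sgn_add, hs, neg_mul, mul_assoc,
      Dpow_mul, Dpow_mul, add_comm (-1) (-(i : ℤ))]
    simp

theorem cj_mul (X Y : PDS d) : cj (X * Y) = cj Y * cj X := by
  obtain ⟨y, hy⟩ := Y.exists_O
  refine hom_ext_pds (cj.comp (AddMonoidHom.mulRight Y))
    (((AddMonoidHom.mulLeft (cj Y))).comp cj) y ?_ ?_ ?_ X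
  · intro N X hX; exact cj_O (mul_O hX hy)
  · intro N X hX
    exact O_mono (by omega) (mul_O (cj_O hy) (cj_O hX))
  · intro a i
    change cj (mon d a i * Y) = cj Y * cj (mon d a i)
    rw [cj_mon, mon_eq, mul_assoc, cj_smul, cj_Dpow_mul, smul_mul_assoc, mul_smul_comm, mul_assoc]

theorem cj_mon_zero (a : A) : cj (mon d a 0) = mon d a 0 := by
  rw [cj_mon, sgn_zero, one_smul]; exact one_mul _

theorem cj_Dpow (i : ℤ) : cj (mon d 1 i) = sgn i • mon d 1 i := by
  rw [cj_mon]; congr 1; exact mul_one _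

theorem cj_one : cj (1 : PDS d) = 1 := cj_mon_zero 1

theorem cj_cj (X : PDS d) : cj (cj X) = X := by
  refine hom_ext_pds (cj.comp cj) (AddMonoidHom.id _) 0 ?_ ?_ ?_ X
  · intro N X hX; exact O_mono (by omega) (cj_O (cj_O hX))
  · intro N X hX; simpa using hX
  · intro a i
    change cj (cj (mon d a i)) = mon d a i
    rw [cj_mon, map_zsmul, cj_mul, cj_mon_zero, cj_Dpow, mul_smul_comm, sgn_smul_smul, ← mon_eq]

theorem cj_pow (X : PDS d) (n : ℕ) : cj (X ^ n) = cj X ^ n := by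
  induction n with
  | zero => simp [cj_one]
  | succ n ih => rw [pow_succ, cj_mul, ih, pow_succ']

/-! ### The trace -/

/-- Residue modulo total derivatives. -/
def tr : PDS d →+ A ⧸ (d : A →+ A).range := (QuotientAddGroup.mk' _).comp (cf (-1))

theorem tr_eq (X : PDS d) : tr X = QuotientAddGroup.mk (cf (-1) X) := rfl

theorem tr_eq_of_cf {X Y : PDS d} (h : cf (-1) X = cf (-1) Y) : tr X = tr Y := by
  rw [tr_eq, tr_eq, h]

theorem tr_low {X : PDS d} (hX : X ∈ O d (-2)) : tr X = 0 := by
  rw [tr_eq, hX _ (by norm_num)]; rfl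

theorem tr_d (a : A) : ((d a : A) : A ⧸ (d : A →+ A).range) = 0 := by
  rw [QuotientAddGroup.eq_zero_iff]; exact ⟨a, rfl⟩

theorem cf_mul_D (X : PDS d) (n j : ℤ) : cf n (X * mon d 1 j) = cf (n - j) X := by
  have := hom_ext ((cf n).comp (AddMonoidHom.mulRight (mon d 1 j)))
    (cf (n - j)) ⟨n - j - 1, fun Y hY => by
      simp only [AddMonoidHom.comp_apply, AddMonoidHom.coe_mulRight]
      rw [mul_O hY (mon_O 1 j) n (by omega), hY _ (by omega)]⟩ (fun b i => by
      simp only [AddMonoidHom.comp_apply, AddMonoidHom.coe_mulRight, mon_mul_mon_one, cf_mon]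
      split_ifs <;> first | rfl | omega)
  exact DFunLike.congr_fun this X

theorem tr_D (X : PDS d) : tr (mon d 1 1 * X) = tr (X * mon d 1 1) := by
  rw [tr_eq, tr_eq, cf_D_mul, cf_mul_D, QuotientAddGroup.mk_add, tr_d, add_zero]

theorem tr_smul (a : A) (X : PDS d) : tr (mon d a 0 * X) = tr (X * mon d a 0) := by
  have := hom_ext (tr.comp (AddMonoidHom.mulLeft (mon d a 0)))
    (tr.comp (AddMonoidHom.mulRight (mon d a 0))) ⟨-2, fun Y hY => by
      simp only [AddMonoidHom.comp_apply, AddMonoidHom.coe_mulRight, AddMonoidHom.coe_mulLeft]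
      rw [tr_low (O_mono (by norm_num) (mul_O (mon_O a 0) hY)),
        tr_low (O_mono (by norm_num) (mul_O hY (mon_O a 0)))]⟩ (fun b i => by
      simp only [AddMonoidHom.comp_apply, AddMonoidHom.coe_mulRight, AddMonoidHom.coe_mulLeft]
      apply tr_eq_of_cf
      rw [mon_zero_mul_mon, cf_mon_mul_mon, cf_mon]
      rcases lt_trichotomy i (-1) with h | h | h
      · rw [if_neg (by omega), if_neg (by omega)]
      · subst h; simp [gbinom_zero, mul_comm]
      · rw [if_neg (by omega), if_pos (by omega)]
        lift i to ℕ using (by omega)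
        rw [gbinom_nat_lt i _ (by omega)]; simp)
  exact DFunLike.congr_fun this X

theorem tr_Dinv (X : PDS d) : tr (mon d 1 (-1) * X) = tr (X * mon d 1 (-1)) := by
  have h := tr_D (mon d 1 (-1) * X * mon d 1 (-1))
  rw [mul_assoc, D_mul_Dinv_mul, mul_assoc, mul_assoc, Dpow_mul] at h
  rw [h]
  congr 2
  exact (mul_one _).symm

theorem tr_comm_mul {X X' : PDS d} (h : ∀ Y, tr (X * Y) = tr (Y * X))
    (h' : ∀ Y, tr (X' * Y) = tr (Y * X')) (Y : PDS d) : tr ((X * X') * Y) = tr (Y * (X * X')) := by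
  rw [mul_assoc, h, mul_assoc, h', mul_assoc]

theorem tr_Dpow (i : ℤ) : ∀ X : PDS d, tr (mon d 1 i * X) = tr (X * mon d 1 i) := by
  induction i with
  | zero => exact tr_smul 1
  | succ i ih => rw [← Dpow_mul]; exact tr_comm_mul ih tr_D
  | pred i ih => rw [sub_eq_add_neg, ← Dpow_mul]; exact tr_comm_mul ih tr_Dinv

theorem tr_comm (X Y : PDS d) : tr (X * Y) = tr (Y * X) := by
  obtain ⟨y, hy⟩ := Y.exists_O
  have := hom_ext (tr.comp (AddMonoidHom.mulRight Y))
    (tr.comp (AddMonoidHom.mulLeft Y)) ⟨-2 - y, fun Z hZ => by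
      simp only [AddMonoidHom.comp_apply, AddMonoidHom.coe_mulRight, AddMonoidHom.coe_mulLeft]
      rw [tr_low (O_mono (by omega) (mul_O hZ hy)),
        tr_low (O_mono (by omega) (mul_O hy hZ))]⟩ (fun b i => by
      change tr (mon d b i * Y) = tr (Y * mon d b i)
      rw [mon_eq]
      exact tr_comm_mul (tr_smul b) (tr_Dpow i) Y)
  exact DFunLike.congr_fun this X

theorem tr_cj (X : PDS d) : tr (cj X) = - tr X := by
  have := hom_ext (tr.comp cj) (-(tr : PDS d →+ _)) ⟨-2, fun Y hY => by
      simp only [AddMonoidHom.comp_apply, AddMonoidHom.neg_apply]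
      rw [tr_low hY, tr_low (cj_O hY), neg_zero]⟩ (fun b i => by
      simp only [AddMonoidHom.comp_apply, AddMonoidHom.neg_apply]
      rw [cj_mon, map_zsmul, tr_comm, ← mon_eq, tr_eq, cf_mon]
      split_ifs with h
      · rw [← h]; simp [sgn]
      · simp [QuotientAddGroup.mk_zero])
  exact DFunLike.congr_fun this X

/-! ### Vanishing of the trace on special elements -/

theorem pow_O {X : PDS d} (hX : X ∈ O d (-1)) (n : ℕ) : X ^ n ∈ O d (-n) := by
  induction n with
  | zero => simpa [one_def] using mon_O (d := d) 1 0
  | succ n ih =>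
    rw [pow_succ]
    exact O_mono (by push_cast; omega) (mul_O ih hX)

theorem tr_pow_low {X : PDS d} (hX : X ∈ O d (-1)) (e : ℕ) : tr (X ^ (2 ^ (e + 1))) = 0 := by
  refine tr_low (O_mono ?_ (pow_O hX _))
  have : 1 ≤ 2 ^ e := Nat.one_le_two_pow
  rw [pow_succ]
  push_cast
  have : (1 : ℤ) ≤ 2 ^ e := by exact_mod_cast this
  omega

/-- Differential operators. -/
def IsDiff (X : PDS d) : Prop := ∀ n, n < 0 → cf n X = 0

theorem IsDiff.mul {X Y : PDS d} (hX : IsDiff X) (hY : IsDiff Y) : IsDiff (X * Y) := by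
  intro n hn
  rw [cf_mul]
  apply finsum_eq_zero_of_forall_eq_zero
  rintro ⟨i, k⟩
  dsimp only
  by_cases hi : i < 0
  · rw [hX i hi]; simp
  by_cases hj : n - i + k < 0
  · rw [hY _ hj, diter_zero]; simp
  lift i to ℕ using (by omega)
  rw [gbinom_nat_lt i k (by omega), zero_smul]

theorem isDiff_mon (a : A) {i : ℤ} (hi : 0 ≤ i) : IsDiff (mon d a i) :=
  fun n hn => if_neg (by omega)

theorem IsDiff.pow {X : PDS d} (hX : IsDiff X) (n : ℕ) : IsDiff (X ^ n) := by
  induction n with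
  | zero => rw [pow_zero]; exact isDiff_mon 1 le_rfl
  | succ n ih => rw [pow_succ]; exact ih.mul hX

theorem IsDiff.add {X Y : PDS d} (hX : IsDiff X) (hY : IsDiff Y) : IsDiff (X + Y) := by
  intro n hn
  rw [map_add, hX n hn, hY n hn, add_zero]

theorem IsDiff.tr {X : PDS d} (hX : IsDiff X) : tr X = 0 := by
  rw [tr_eq, hX _ (by norm_num)]; rfl

theorem tr_mon_sq (a : A) (i : ℤ) : tr (mon d a i * mon d a i) = 0 := by
  rw [tr_eq, cf_mon_mul_mon]
  split_ifs with h
  · lift i to ℕ using (by omega)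
    rw [gbinom_nat_lt i _ (by omega), zero_smul]; rfl
  · rfl

theorem sub_mem_O {N : ℤ} {X Y : PDS d} (hX : X ∈ O d N) (hY : Y ∈ O d N) (h : cf N X = cf N Y) :
    X - Y ∈ O d (N - 1) := by
  intro i hi
  rw [map_sub]
  by_cases hN : i = N
  · rw [hN, h, sub_self]
  · rw [hX i (by omega), hY i (by omega), sub_self]

theorem tr_sq_two_torsion (X : PDS d) (hX : X + X = 0) : tr (X * X) = 0 := by
  have key : ∀ k : ℕ, ∀ X ∈ O d (-1 + k), X + X = 0 → tr (X * X) = 0 := by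
    intro k
    induction k with
    | zero =>
      intro X hX _
      exact tr_low (O_mono (by norm_num) (mul_O hX hX))
    | succ k ih =>
      intro X hX h2
      set m := mon d (cf (-1 + (k + 1 : ℕ)) X) (-1 + (k + 1 : ℕ)) with hm
      have hm2 : m + m = 0 := by
        rw [hm, ← mon_add, ← map_add, h2, map_zero]
        ext n; rw [cf_mon]; simp
      have hY : X - m ∈ O d (-1 + k) := by
        refine O_mono (by push_cast; omega) (sub_mem_O hX (mon_O _ _) ?_)
        rw [cf_mon, if_pos rfl]
      have hY2 : (X - m) + (X - m) = 0 := by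
        rw [show (X - m) + (X - m) = (X + X) - (m + m) by abel, h2, hm2, sub_zero]
      have e : X * X = (X - m) * (X - m) + ((X - m) * m + m * (X - m)) + m * m := by noncomm_ring
      rw [e, map_add, map_add, map_add, ih _ hY hY2, tr_comm m, ← map_add, ← add_mul, hY2, zero_mul,
        map_zero, hm, tr_mon_sq, add_zero, add_zero]
  obtain ⟨N, hN⟩ := X.exists_O
  exact key (N + 1).toNat X (O_mono (by omega) hN) hX

theorem tr_pow_two_torsion (X : PDS d) (hX : X + X = 0) (e : ℕ) : tr (X ^ (2 ^ (e + 1))) = 0 := by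
  rw [pow_succ, pow_mul, pow_two]
  apply tr_sq_two_torsion
  obtain ⟨n, hn⟩ := Nat.exists_eq_succ_of_ne_zero (pow_ne_zero e (two_ne_zero (α := ℕ)))
  rw [hn, Nat.succ_eq_add_one, pow_succ, ← mul_add, hX, mul_zero]

/-- The symmetric sandwich `D^j P D^j`. -/
def sand (j : ℤ) (P : PDS d) : PDS d := mon d 1 j * P * mon d 1 j

theorem cj_sand (j : ℤ) (P : PDS d) : cj (sand j P) = sand j (cj P) := by
  rw [sand, cj_mul_D, cj_Dpow_mul, mul_smul_comm, sgn_smul_smul, sand, mul_assoc]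

theorem sand_O {N : ℤ} {P : PDS d} (hP : P ∈ O d N) (j : ℤ) : sand j P ∈ O d (2 * j + N) :=
  O_mono (by omega) (mul_O (mul_O (mon_O 1 j) hP) (mon_O 1 j))

theorem cf_sand_mon (j : ℤ) (a : A) (i : ℤ) : cf (2 * j + i) (sand j (mon d a i)) = a := by
  rw [sand, cf_mul_D, show 2 * j + i - j = j + i - (0 : ℕ) by push_cast; ring, cf_mon_mul_mon_sub]
  simp [gbinom_zero]

theorem sand_add (j : ℤ) (P Q : PDS d) : sand j (P + Q) = sand j P + sand j Q := by
  simp only [sand, mul_add, add_mul]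

theorem sand_neg (j : ℤ) (P : PDS d) : sand j (-P) = -sand j P := by
  simp only [sand, mul_neg, neg_mul]

theorem tr_blocks (j k : ℤ) (f t b : A) (e : ℕ) :
    tr ((sand j (mon d f 0) * sand k (mon d t 1 + mon d b 0)) ^ (2 ^ (e + 1))) = 0 := by
  set L := mon d t 1 + mon d b 0 with hL
  have e1 : sand j (mon d f 0) * sand k L
      = mon d 1 j * (mon d f 0 * mon d 1 (j + k) * L * mon d 1 k) := by
    rw [← Dpow_mul]; simp only [sand, mul_assoc]
  have e2 : (mon d f 0 * mon d 1 (j + k) * L * mon d 1 k) * mon d 1 j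
      = mon d f 0 * mon d 1 (j + k) * L * mon d 1 (j + k) := by
    rw [mul_assoc _ (mon d 1 k), Dpow_mul, add_comm k j]
  rw [e1, tr_pow_comm (tr (d := d)) tr_comm, e2]
  by_cases h : 0 ≤ j + k
  · refine IsDiff.tr (IsDiff.pow ?_ _)
    exact (((isDiff_mon f le_rfl).mul (isDiff_mon 1 h)).mul
      ((isDiff_mon t (by norm_num)).add (isDiff_mon b le_rfl))).mul (isDiff_mon 1 h)
  · refine tr_pow_low ?_ e
    refine O_mono ?_ (mul_O (mul_O (mul_O (mon_O f 0) (mon_O 1 (j + k)))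
      (add_mem (mon_O t 1) (O_mono (by norm_num) (mon_O b 0)))) (mon_O 1 (j + k)))
    omega

theorem mon_zero (i : ℤ) : mon d 0 i = 0 := by
  ext n; rw [cf_mon]; simp

theorem tr_sand_skew (j : ℤ) (f : A) (e : ℕ) (T : PDS d) (hT : cj T = -T) :
    tr ((sand j (mon d f 0) * T) ^ (2 ^ (e + 1))) = 0 := by
  set F := sand j (mon d f 0) with hF
  have hFO : F ∈ O d (2 * j + 0) := sand_O (mon_O f 0) j
  have hFc : cj F = F := by rw [hF, cj_sand, cj_mon_zero]
  have hadd := phi_skew_add (tr (d := d)) tr_comm F cj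
    (fun x y => by rw [cj_mul, cj_mul, hFc, mul_assoc]) cj_cj
    (fun x => by rw [← hFc, ← cj_mul, hFc, tr_cj, tr_comm]) e
  have key : ∀ k : ℕ, ∀ T ∈ O d (-1 - 2 * j + k), cj T = -T →
      tr ((F * T) ^ (2 ^ (e + 1))) = 0 := by
    intro k
    induction k with
    | zero =>
      intro T hTO _
      exact tr_pow_low (O_mono (by push_cast; omega) (mul_O hFO hTO)) e
    | succ k ih =>
      intro T hTO hT
      generalize hN : -1 - 2 * j + ((k + 1 : ℕ) : ℤ) = N at hTO
      have hN' : -1 - 2 * j + (k : ℤ) = N - 1 := by rw [← hN]; push_cast; ring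
      rw [hN'] at ih
      suffices h : ∃ G : PDS d, G ∈ O d N ∧ cf N T = cf N G ∧ cj G = -G ∧
          tr ((F * G) ^ (2 ^ (e + 1))) = 0 by
        obtain ⟨G, hG, hc, hs, ht⟩ := h
        have hs' : cj (T - G) = -(T - G) := by rw [map_sub, hT, hs]; abel
        have := hadd (T - G) G hs' hs
        rw [sub_add_cancel, ht, ih _ (sub_mem_O hTO hG hc) hs', add_zero] at this
        exact this
      have htop := cf_cj_top hTO
      have hsub := cf_cj_sub hTO
      rw [hT, map_neg] at htop hsub
      rcases Int.even_or_odd' N with ⟨i, rfl | rfl⟩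
      · -- even order
        rw [sgn_even, one_smul] at htop
        set c := cf (2 * i) T with hc
        have h2 : c + c = 0 := by nth_rewrite 1 [← htop]; simp
        have h2' : sand i (mon d c 0) + sand i (mon d c 0) = 0 := by
          rw [← sand_add, ← mon_add, h2, mon_zero]; simp [sand]
        refine ⟨sand i (mon d c 0), O_mono (by omega) (sand_O (mon_O c 0) i), ?_, ?_, ?_⟩
        · have := cf_sand_mon (d := d) i c 0
          rw [add_zero] at this; exact this.symm
        · rw [cj_sand, cj_mon_zero]; exact eq_neg_of_add_eq_zero_left h2'
        · apply tr_pow_two_torsion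
          rw [← mul_add, h2', mul_zero]
      · -- odd order
        rw [add_sub_cancel_right, sgn_even, sgn_odd] at hsub
        set t := cf (2 * i + 1) T with ht
        set b := cf (2 * i) T - i • d t with hb
        have htb : d t = b + b := by
          simp only [zsmul_eq_mul] at hsub hb ⊢
          push_cast at hsub
          rw [hb]
          linear_combination hsub
        refine ⟨sand i (mon d t 1 + mon d b 0), ?_, ?_, ?_, tr_blocks j i f t b e⟩
        · exact sand_O (add_mem (mon_O t 1) (O_mono (by norm_num) (mon_O b 0))) i
        · rw [sand_add, map_add, cf_sand_mon, sand_O (mon_O b 0) i _ (by omega), add_zero]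
        · rw [cj_sand, ← sand_neg]
          congr 1
          rw [map_add, cj_mon_zero, cj_mon, sgn_one, D_mul_mon, htb, mon_add, neg_one_smul, zero_add]
          abel
  obtain ⟨N, hN⟩ := T.exists_O
  exact key (N + 1 + 2 * j).toNat T (O_mono (by omega) hN) hT

theorem tr_skew_symm (e : ℕ) (T M : PDS d) (hT : cj T = -T) (hM : cj M = M) :
    tr ((T * M) ^ (2 ^ (e + 1))) = 0 := by
  obtain ⟨s, hs⟩ := T.exists_O
  have hadd := phi_skew_add (tr (d := d)) tr_comm T (-cj)
    (fun x y => by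
      simp only [AddMonoidHom.neg_apply]
      rw [cj_mul, cj_mul, hT]; noncomm_ring)
    (fun x => by simp only [AddMonoidHom.neg_apply, map_neg, neg_neg, cj_cj])
    (fun x => by
      simp only [AddMonoidHom.neg_apply]
      rw [mul_neg, ← neg_mul, ← hT, ← cj_mul, tr_cj, tr_comm]) e
  have key : ∀ k : ℕ, ∀ M ∈ O d (-1 - s + k), cj M = M →
      tr ((T * M) ^ (2 ^ (e + 1))) = 0 := by
    intro k
    induction k with
    | zero =>
      intro M hMO _
      exact tr_pow_low (O_mono (by push_cast; omega) (mul_O hs hMO)) e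
    | succ k ih =>
      intro M hMO hM
      generalize hN : -1 - s + ((k + 1 : ℕ) : ℤ) = N at hMO
      have hN' : -1 - s + (k : ℤ) = N - 1 := by rw [← hN]; push_cast; ring
      rw [hN'] at ih
      suffices h : ∃ G : PDS d, G ∈ O d N ∧ cf N M = cf N G ∧ cj G = G ∧
          tr ((T * G) ^ (2 ^ (e + 1))) = 0 by
        obtain ⟨G, hG, hc, hs, ht⟩ := h
        have hs' : cj (M - G) = M - G := by rw [map_sub, hM, hs]
        have := hadd (M - G) G (by rw [AddMonoidHom.neg_apply, hs']) (by rw [AddMonoidHom.neg_apply, hs])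
        rw [sub_add_cancel, ht, ih _ (sub_mem_O hMO hG hc) hs', add_zero] at this
        exact this
      have htop := cf_cj_top hMO
      have hsub := cf_cj_sub hMO
      rw [hM] at htop hsub
      rcases Int.even_or_odd' N with ⟨i, rfl | rfl⟩
      · set c := cf (2 * i) M with hc
        refine ⟨sand i (mon d c 0), O_mono (by omega) (sand_O (mon_O c 0) i), ?_, ?_, ?_⟩
        · have := cf_sand_mon (d := d) i c 0
          rw [add_zero] at this; exact this.symm
        · rw [cj_sand, cj_mon_zero]
        · rw [tr_pow_comm (tr (d := d)) tr_comm]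
          exact tr_sand_skew i c e T hT
      · rw [add_sub_cancel_right, sgn_even, sgn_odd] at hsub
        rw [sgn_odd, neg_one_smul] at htop
        set m := cf (2 * i + 1) M with hm
        have h2 : m + m = 0 := by nth_rewrite 1 [htop]; simp
        have hd2 : d m + d m = 0 := by rw [← map_add, h2, map_zero]
        have hd : d m = 0 := by
          simp only [zsmul_eq_mul] at hsub
          push_cast at hsub
          linear_combination hsub - (i : A) * hd2 + (0 : A)
        have h2' : mon d m (2 * i + 1) + mon d m (2 * i + 1) = 0 := by
          rw [← mon_add, h2, mon_zero]
        refine ⟨mon d m (2 * i + 1), mon_O _ _, ?_, ?_, ?_⟩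
        · rw [cf_mon, if_pos rfl]
        · rw [cj_mon, sgn_odd, neg_one_smul]
          have e1 : mon d 1 (2 * i + 1) * mon d m 0 = mon d m (2 * i + 1) := by
            refine ext_sub (2 * i + 1 + 0) (mul_O (mon_O _ _) (mon_O _ _))
              (O_mono (by omega) (mon_O _ _)) ?_
            intro k
            rw [cf_mon_mul_mon_sub, cf_mon]
            cases k with
            | zero => simp [gbinom_zero]
            | succ k =>
              rw [Function.iterate_succ_apply, hd, diter_zero, if_neg (by push_cast; omega)]
              simp
          rw [e1]
          exact (eq_neg_of_add_eq_zero_left h2').symm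
        · apply tr_pow_two_torsion
          rw [← mul_add, h2', mul_zero]
  obtain ⟨N, hN⟩ := M.exists_O
  exact key (N + 1 + s).toNat M (O_mono (by omega) hN) hM

theorem pow_val (X : PDS d) (n : ℕ) : (X ^ n).1 = pdsPow (⇑d) X.1 n := by
  induction n with
  | zero => rw [pow_zero]; rfl
  | succ n ih => rw [pow_succ, mul_val, ih]; rfl

theorem main (R S T : PDS d) (hl : S * T = 1) (hr : T * S = 1) (hR : cj R = -(S * R * T))
    (hS : cj S = -S) (i : ℕ) (hi : 1 ≤ i) : tr (R ^ (2 * i)) = 0 := by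
  obtain ⟨e, o, ho, he⟩ := Nat.exists_eq_two_pow_mul_odd (n := i) (by omega)
  have hT : cj T = -T := by
    have h := congrArg cj hl
    rw [cj_mul, hS, cj_one] at h
    calc cj T = (cj T * -S) * (-T) := by rw [mul_assoc, neg_mul_neg, hl, mul_one]
      _ = -T := by rw [h, one_mul]
  have hpow : ∀ n : ℕ, (S * R * T) ^ n = S * R ^ n * T := by
    intro n
    induction n with
    | zero => simp [hl]
    | succ n ih =>
      rw [pow_succ, ih, pow_succ]
      calc S * R ^ n * T * (S * R * T) = S * R ^ n * (T * S) * R * T := by noncomm_ring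
        _ = _ := by rw [hr, mul_one]; noncomm_ring
  have hRo : cj (R ^ o) = -(S * R ^ o * T) := by
    rw [cj_pow, hR, ho.neg_pow, hpow]
  have hM : cj (S * R ^ o) = S * R ^ o := by
    rw [cj_mul, hRo, hS, neg_mul_neg, mul_assoc, hr, mul_one]
  have := tr_skew_symm e T (S * R ^ o) hT hM
  rw [← mul_assoc, hr, one_mul, ← pow_mul] at this
  rw [he]
  convert this using 3
  ring

end PDS

/-- if `R⁺ = −S R S⁻¹` and `S⁺ = −S` with `S` invertible, then for
every positive integer `i` the residue of `R^{2i}` is a total derivative. -/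
theorem res_even_power_mem_range_d (d : Derivation ℤ A A) (R S Sinv : ℤ → A)
    (hR : PDSBdd R) (hS : PDSBdd S) (hSinv : PDSBdd Sinv)
    (hSl : pdsMul (⇑d) S Sinv = pdsOne) (hSr : pdsMul (⇑d) Sinv S = pdsOne)
    (hRconj : pdsConj (⇑d) R = -(pdsMul (⇑d) (pdsMul (⇑d) S R) Sinv))
    (hSconj : pdsConj (⇑d) S = -S) :
    ∀ i : ℕ, 1 ≤ i → pdsRes (pdsPow (⇑d) R (2 * i)) ∈ Set.range (⇑d) := by
  intro i hi
  let R' : PDS d := ⟨R, hR⟩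
  let S' : PDS d := ⟨S, hS⟩
  let T' : PDS d := ⟨Sinv, hSinv⟩
  have h := PDS.main R' S' T' (Subtype.ext hSl) (Subtype.ext hSr) (Subtype.ext hRconj)
    (Subtype.ext hSconj) i hi
  rw [PDS.tr_eq, QuotientAddGroup.eq_zero_iff] at h
  obtain ⟨a, ha⟩ := h
  refine ⟨a, ?_⟩
  have h2 := congrFun (PDS.pow_val R' (2 * i)) (-1)
  exact ha.trans h2

end
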